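/- arXiv:1402.0221 — 4 statements merged into one kernel-verified Lean document; each statement's English description precedes it below -/
import Mathlib

section
/- Let n = p^μ be a prime power with p ≥ 7, μ ≥ 2, and n ≥ 289. Let a ∈ {4, 5} and let b, c be integers with a ≤ b < c < n/2, c = a + b − 2, and ⌊b/a⌋ ≤ 10, such that (1, 1, c, n−b, n−a) is a minimal zero-sum sequence over Z/n. Then there exists a unit m modulo n with |m|_n + |m|_n + |m·c|_n + |m·(n−b)|_n + |m·(n−a)|_n = n. -/
/-- `lpr n x` is the least positive residue of `x` modulo `n` (in `[1, n]`). -/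
def lpr (n x : ℕ) : ℕ := if x % n = 0 then n else x % n

theorem lpr_eq_of_add_mul_eq {n x k q r : ℕ} (hr : 0 < r) (hrn : r < n)
    (h : x + k * n = q * n + r) : lpr n x = r := by
  have hmod : x % n = r := by
    have := congrArg (· % n) h
    simpa [Nat.mod_eq_of_lt hrn] using this
  rw [lpr, hmod, if_neg hr.ne']

/-- A sufficient condition for `m` to send the sequence `(1, 1, c, n - b, n - a)` to one whose
least positive residues sum to `n`: `m * a < n` and `m * b < s * n < m * c`. -/
theorem sum_lpr_eq {n a b c s m : ℕ} (ha : 2 < a) (han : a ≤ n) (hbn : b ≤ n)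
    (hcab : c + 2 = a + b) (hma : m * a < n) (hmb : m * b < s * n) (hmc : s * n < m * c) :
    lpr n m + lpr n m + lpr n (m * c) + lpr n (m * (n - b)) + lpr n (m * (n - a)) = n := by
  have hm : 0 < m := Nat.pos_of_ne_zero (by rintro rfl; simp at hmc)
  have hsum : m * c + 2 * m = m * a + m * b := by
    rw [← mul_add, ← hcab]; ring
  have hm2 : m * 2 < m * a := Nat.mul_lt_mul_of_pos_left ha hm
  have hnb : m * (n - b) + m * b = m * n := by rw [← mul_add, Nat.sub_add_cancel hbn]
  have hna : m * (n - a) + m * a = m * n := by rw [← mul_add, Nat.sub_add_cancel han]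
  rw [lpr_eq_of_add_mul_eq (x := m) (k := 0) (q := 0) hm (by omega) (by simp),
    lpr_eq_of_add_mul_eq (x := m * c) (k := 0) (q := s) (r := m * c - s * n)
      (by omega) (by omega) (by omega),
    lpr_eq_of_add_mul_eq (x := m * (n - b)) (k := s) (q := m) (r := s * n - m * b)
      (by omega) (by omega) (by omega),
    lpr_eq_of_add_mul_eq (x := m * (n - a)) (k := 1) (q := m) (r := n - m * a)
      (by omega) (by have := Nat.mul_pos hm (by omega : 0 < a); omega) (by omega)]
  omega

theorem coprime_pow_or_coprime_succ_pow {p : ℕ} (hp : p.Prime) (m k : ℕ) :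
    Nat.Coprime m (p ^ k) ∨ Nat.Coprime (m + 1) (p ^ k) := by
  by_cases h : p ∣ m
  · right
    refine Nat.Coprime.pow_right k (Nat.Coprime.symm (hp.coprime_iff_not_dvd.2 fun h' => ?_))
    exact hp.one_lt.ne' (Nat.dvd_one.1 ((Nat.dvd_add_right h).1 h'))
  · exact .inl (Nat.Coprime.pow_right k (Nat.Coprime.symm (hp.coprime_iff_not_dvd.2 h)))

theorem stmt_8 (p μ n a b c : ℕ) (hp : p.Prime) (hp7 : 7 ≤ p) (hμ : 2 ≤ μ)
    (hn : n = p ^ μ) (hn289 : 289 ≤ n)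
    (ha : a = 4 ∨ a = 5) (hab : a ≤ b) (hbc : b < c) (hc : 2 * c < n)
    (hcab : c = a + b - 2) (hs : b / a ≤ 10)
    (hzs : n ∣ ∑ i, (![1, 1, c, n - b, n - a] : Fin 5 → ℕ) i)
    (hmin : ∀ s : Finset (Fin 5), s.Nonempty → s ≠ Finset.univ →
      ¬ n ∣ ∑ i ∈ s, (![1, 1, c, n - b, n - a] : Fin 5 → ℕ) i) :
    ∃ m : ℕ, Nat.gcd m n = 1 ∧
      lpr n m + lpr n m + lpr n (m * c) + lpr n (m * (n - b)) +
        lpr n (m * (n - a)) = n := by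
  obtain ⟨s, hsb⟩ : ∃ s, s = b / a := ⟨_, rfl⟩
  have hc2 : c + 2 = a + b := by omega
  have hs1 : 1 ≤ s := by rcases ha with rfl | rfl <;> omega
  have hs10 : s ≤ 10 := hsb ▸ hs
  have hsab : a * s ≤ b := hsb ▸ Nat.mul_div_le b a
  have hgap : 2 * b * c < (a - 2) * s * n := by
    rcases ha with rfl | rfl
    · obtain rfl : c = b + 2 := by omega
      have hb : b ≤ 4 * s + 3 := by omega
      have : 2 * b * (b + 2) ≤ 2 * (4 * s + 3) * (4 * s + 3 + 2) := by gcongr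
      nlinarith
    · obtain rfl : c = b + 3 := by omega
      have hb : b ≤ 5 * s + 4 := by omega
      have : 2 * b * (b + 3) ≤ 2 * (5 * s + 4) * (5 * s + 4 + 3) := by gcongr
      nlinarith
  have hlower : s * n < (s * n / c + 1) * c := by
    rw [mul_comm _ c]; exact Nat.lt_mul_div_succ _ hbc.pos
  have hupper : (s * n / c + 1 + 1) * b < s * n := by
    have hdiv : s * n / c * c ≤ s * n := Nat.div_mul_le_self _ _
    have hc' : c = b + (a - 2) := by omega
    have : (s * n / c + 1 + 1) * b * c < s * n * c := by
      calc (s * n / c + 1 + 1) * b * c = s * n / c * c * b + 2 * b * c := by ring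
        _ < s * n * b + (a - 2) * s * n :=
          Nat.add_lt_add_of_le_of_lt (Nat.mul_le_mul_right b hdiv) hgap
        _ = s * n * (b + (a - 2)) := by ring
        _ = s * n * c := by rw [← hc']
    exact lt_of_mul_lt_mul_right this (Nat.zero_le _)
  have key (m : ℕ) (hm1 : s * n / c + 1 ≤ m) (hm2 : m ≤ s * n / c + 1 + 1) :
      lpr n m + lpr n m + lpr n (m * c) + lpr n (m * (n - b)) +
        lpr n (m * (n - a)) = n := by
    have hmb : m * b < s * n := (Nat.mul_le_mul_right b hm2).trans_lt hupper
    have hma : s * (m * a) < s * n :=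
      calc s * (m * a) = m * (a * s) := by ring
        _ ≤ m * b := by gcongr
        _ < s * n := hmb
    exact sum_lpr_eq (by omega) (by omega) (by omega) hc2
      (lt_of_mul_lt_mul_left hma (Nat.zero_le _)) hmb
      (hlower.trans_le (Nat.mul_le_mul_right c hm1))
  rcases coprime_pow_or_coprime_succ_pow hp (s * n / c + 1) μ with h | h
  · exact ⟨_, hn ▸ h, key _ le_rfl (Nat.le_succ _)⟩
  · exact ⟨_, hn ▸ h, key _ (Nat.le_succ _) le_rfl⟩
end

section
/- Let n = p^μ be a prime power with p ≥ 7, μ ≥ 2, and n ≥ 289. Let a, b, c be integers with 4 ≤ a ≤ b < c < n/2 and c = a + b − 2, such that (1, 1, c, n−b, n−a) is a minimal zero-sum sequence over Z/n. Then there exists a unit m modulo n with |m|_n + |m|_n + |m·c|_n + |m·(n−b)|_n + |m·(n−a)|_n = n. -/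
theorem lpr_eq_of_eq_mul_add {n x q r : ℕ} (h : x = q * n + r) (hr : 0 < r) (hrn : r < n) :
    lpr n x = r := by
  have hx : x % n = r := by
    rw [h, Nat.mul_add_mod_of_lt hrn]
  rw [lpr, hx, if_neg hr.ne']

/-- A unit `m` with `m * a ≤ n` that has a multiple of `n` between `m * b` and `m * c`
witnesses index one. -/
theorem lpr_sum_eq_of_mul_between {n a b c m k : ℕ} (ha : 4 ≤ a) (hab : a ≤ b)
    (hc : 2 * c < n) (hcab : c + 2 = a + b) (hm : Nat.gcd m n = 1)
    (hma : m * a ≤ n) (hmb : m * b ≤ k * n) (hmc : k * n ≤ m * c) :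
    lpr n m + lpr n m + lpr n (m * c) + lpr n (m * (n - b)) + lpr n (m * (n - a)) = n := by
  have hndvd : ∀ x, 0 < x → x < n → ¬ n ∣ m * x := fun x h0 hx h =>
    absurd (Nat.le_of_dvd h0 ((Nat.Coprime.symm hm).dvd_of_dvd_mul_left h)) (by omega)
  have hma' : m * a < n := lt_of_le_of_ne hma fun h =>
    hndvd a (by omega) (by omega) (Dvd.intro 1 (by omega))
  have hmb' : m * b < k * n := lt_of_le_of_ne hmb fun h =>
    hndvd b (by omega) (by omega) (Dvd.intro_left k h.symm)
  have hmc' : k * n < m * c := lt_of_le_of_ne hmc fun h =>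
    hndvd c (by omega) (by omega) (Dvd.intro_left k h)
  have hm0 : 0 < m := by
    rcases Nat.eq_zero_or_pos m with rfl | h
    · simp at hmc'
    · exact h
  have hsum : m * c + 2 * m = m * a + m * b := by
    rw [← mul_add, ← hcab]; ring
  have h4m : 4 * m ≤ m * a := by rw [mul_comm]; gcongr
  have hkm : k ≤ m := by
    by_contra! h
    have h1 : m * n ≤ k * n := by gcongr
    have h2 : m * c ≤ m * n := by gcongr; omega
    omega
  obtain ⟨d, rfl⟩ := Nat.exists_eq_add_of_le hkm
  obtain ⟨e, he⟩ : ∃ e, k + d = e + 1 := ⟨k + d - 1, by omega⟩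
  have hb : (k + d) * (n - b) + (k + d) * b = (k + d) * n := by
    rw [← mul_add]; congr 1; omega
  have ha' : (k + d) * (n - a) + (k + d) * a = (k + d) * n := by
    rw [← mul_add]; congr 1; omega
  have hdn : (k + d) * n = k * n + d * n := by ring
  have hen : (k + d) * n = e * n + n := by rw [he]; ring
  rw [lpr_eq_of_eq_mul_add (q := 0) (x := k + d) (r := k + d) (by omega) hm0 (by omega),
    lpr_eq_of_eq_mul_add (q := k) (x := (k + d) * c) (r := (k + d) * c - k * n)
      (by omega) (by omega) (by omega),
    lpr_eq_of_eq_mul_add (q := d) (x := (k + d) * (n - b)) (r := k * n - (k + d) * b)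
      (by omega) (by omega) (by omega),
    lpr_eq_of_eq_mul_add (q := e) (x := (k + d) * (n - a)) (r := n - (k + d) * a)
      (by omega) (by omega) (by omega)]
  omega

theorem mul_le_of_mul_le_mul_of_mul_le {m a b k n : ℕ} (hk : 0 < k) (hka : k * a ≤ b)
    (hmb : m * b ≤ k * n) : m * a ≤ n := by
  have h : m * (k * a) ≤ m * b := by gcongr
  exact Nat.le_of_mul_le_mul_left (by linarith [mul_left_comm m k a]) hk

/-- With `c = b + t`, if `[k * n / c, k * n / b]` has length at least `l + 1`, it contains the `l + 1`
consecutive integers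
starting right after `k * n / c`. -/
theorem exists_lt_mul_and_add_mul_le {n b t k l : ℕ} (hb : 0 < b)
    (hl : (l + 1) * (b * (b + t)) ≤ k * t * n) :
    ∃ m, k * n < m * (b + t) ∧ m * (b + t) ≤ k * n + (b + t) ∧ (m + l) * b ≤ k * n := by
  have hc : 0 < b + t := by omega
  obtain ⟨q, h1, h2⟩ : ∃ q, q * (b + t) ≤ k * n ∧ k * n < (q + 1) * (b + t) :=
    ⟨k * n / (b + t), Nat.div_mul_le_self _ _, Nat.lt_mul_of_div_lt (Nat.lt_succ_self _) hc⟩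
  refine ⟨q + 1, h2, by linarith, Nat.le_of_mul_le_mul_left ?_ hc⟩
  nlinarith [Nat.mul_le_mul_left b h1]

section

variable {p n b t : ℕ}

theorem exists_coprime_of_two_le_length {k : ℕ} (hp : p.Prime) (hb : 0 < b) (hk : 0 < k)
    (hkb : k * (t + 2) ≤ b) (hl : 2 * (b * (b + t)) ≤ k * t * n) :
    ∃ m, Nat.Coprime m p ∧ m * (t + 2) ≤ n ∧ m * b ≤ k * n ∧ k * n ≤ m * (b + t) := by
  obtain ⟨m, h1, -, h3⟩ := exists_lt_mul_and_add_mul_le (l := 1) hb hl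
  have h4 : m * b ≤ (m + 1) * b := by gcongr; omega
  have h5 : m * (b + t) ≤ (m + 1) * (b + t) := by gcongr; omega
  by_cases hpm : p ∣ m
  · have hpm' : ¬ p ∣ m + 1 := fun h =>
      hp.one_lt.ne' (Nat.dvd_one.1 ((Nat.dvd_add_right hpm).1 h))
    exact ⟨m + 1, ((hp.coprime_iff_not_dvd).2 hpm').symm,
      mul_le_of_mul_le_mul_of_mul_le hk hkb h3, h3, by omega⟩
  · exact ⟨m, ((hp.coprime_iff_not_dvd).2 hpm).symm,
      mul_le_of_mul_le_mul_of_mul_le hk hkb (by omega), by omega, by omega⟩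

/-- The intervals attached to `k` and `k + 1` each contain an integer, and these two integers
differ by less than `7`. -/
theorem exists_coprime_of_one_le_length {k : ℕ} (hp : p.Prime) (hp7 : 7 ≤ p) (hb : 0 < b)
    (hk : 0 < k) (hkb : (k + 1) * (t + 2) ≤ b) (hl : b * (b + t) ≤ k * t * n) (hn : n ≤ 5 * b) :
    ∃ m j, Nat.Coprime m p ∧ m * (t + 2) ≤ n ∧ m * b ≤ j * n ∧ j * n ≤ m * (b + t) := by
  have hl' : b * (b + t) ≤ (k + 1) * t * n := hl.trans (by gcongr; omega)
  have hkb' : k * (t + 2) ≤ b := le_trans (by gcongr; omega) hkb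
  obtain ⟨m, h1, -, h3⟩ := exists_lt_mul_and_add_mul_le (l := 0) hb (by simpa using hl)
  obtain ⟨m', h1', h2', h3'⟩ := exists_lt_mul_and_add_mul_le (l := 0) hb (by simpa using hl')
  rw [add_zero] at h3 h3'
  have hma := mul_le_of_mul_le_mul_of_mul_le hk hkb' h3
  by_cases hpm : p ∣ m
  · refine ⟨m', k + 1, ((hp.coprime_iff_not_dvd).2 fun hpm' => ?_).symm,
      mul_le_of_mul_le_mul_of_mul_le k.succ_pos hkb h3', h3', h1'.le⟩
    have hlt : m < m' := by
      by_contra! h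
      have : m' * (b + t) ≤ m * (b + t) := by gcongr
      nlinarith
    obtain ⟨d, rfl⟩ := Nat.exists_eq_add_of_lt hlt
    have hd : p ∣ d + 1 := (Nat.dvd_add_right hpm).1 (by rwa [← add_assoc])
    have hd7 := Nat.le_of_dvd d.succ_pos hd
    have : 6 * (b + t) ≤ d * (b + t) := by gcongr; omega
    nlinarith
  · exact ⟨m, k, ((hp.coprime_iff_not_dvd).2 hpm).symm, hma, h3, h1.le⟩

/-- The case `a = 4` with `n - 2 * c` small. -/
theorem exists_coprime_of_small_gap {d : ℕ} (hp : p.Prime) (hp7 : 7 ≤ p) (hb : 134 ≤ b)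
    (hd : 0 < d) (hd' : d ≤ 15) :
    ∃ m j, Nat.Coprime m p ∧ m * 4 ≤ 2 * b + 4 + d ∧ m * b ≤ j * (2 * b + 4 + d) ∧
      j * (2 * b + 4 + d) ≤ m * (b + 2) := by
  obtain ⟨k, h1, h2, h3⟩ : ∃ k, b ≤ k * (4 + d) ∧ (k + 1) * d ≤ b + 2 ∧ 4 * (k + 1) ≤ b := by
    by_cases h : d ≤ 4
    · refine ⟨b / 4 - 1, ?_, ?_, by omega⟩ <;> interval_cases d <;> omega
    · refine ⟨b / (4 + d) + 1, ?_, ?_, ?_⟩ <;> interval_cases d <;> omega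
  by_cases hpm : p ∣ 2 * k + 1
  · refine ⟨2 * (k + 1) + 1, k + 1, ((hp.coprime_iff_not_dvd).2 fun h => ?_).symm, by omega,
      by nlinarith, by nlinarith⟩
    have h2p : p ∣ 2 := (Nat.dvd_add_right hpm).1 h
    have := Nat.le_of_dvd two_pos h2p
    omega
  · exact ⟨2 * k + 1, k, ((hp.coprime_iff_not_dvd).2 hpm).symm, by omega,
      by nlinarith, by nlinarith⟩

theorem exists_coprime_mul_between (hp : p.Prime) (hp7 : 7 ≤ p) (hn : 289 ≤ n) (ht : 2 ≤ t)
    (htb : t + 2 ≤ b) (hc : 2 * (b + t) < n) :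
    ∃ m k, Nat.Coprime m p ∧ m * (t + 2) ≤ n ∧ m * b ≤ k * n ∧ k * n ≤ m * (b + t) := by
  by_contra! key
  have hb : 0 < b := by omega
  have hcop : ∀ q : ℕ, q.Prime → q < 7 → Nat.Coprime q p := fun q hq h =>
    (Nat.coprime_primes hq hp).2 (by omega)
  have c2 := hcop 2 Nat.prime_two (by norm_num)
  have c3 := hcop 3 Nat.prime_three (by norm_num)
  have c5 := hcop 5 Nat.prime_five (by norm_num)
  have k3 := key 3 1 c3
  have k4 := key 4 1 (c2.mul_left c2)
  have k5 := key 5 1 c5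
  have k5' := key 5 2 c5
  have k9 := key 9 4 (c3.mul_left c3)
  have k10 := key 10 3 (c2.mul_left c5)
  obtain ⟨K, hK, hK'⟩ : ∃ K, K * (t + 2) ≤ b ∧ b < (K + 1) * (t + 2) :=
    ⟨b / (t + 2), Nat.div_mul_le_self _ _, Nat.lt_mul_of_div_lt (Nat.lt_succ_self _) (by omega)⟩
  have hK1 : 0 < K := by
    by_contra! h
    obtain rfl : K = 0 := by omega
    omega
  have two : ∀ j, j * (b + t) ≤ n → j * (K * t) < 2 * b := fun j hj => by
    by_contra! h
    obtain ⟨m, h1, h2, h3, h4⟩ := exists_coprime_of_two_le_length (n := n) hp hb hK1 hK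
      (by nlinarith [Nat.mul_le_mul_left (K * t) hj, Nat.mul_le_mul_right (b + t) h])
    exact absurd (key m K h1 h2 h3) (by omega)
  obtain ⟨L, rfl⟩ := Nat.exists_eq_add_of_le' hK1
  have one : n ≤ 5 * b → 1 ≤ L → L * t * n < b * (b + t) := fun hn5 hL => by
    by_contra! h
    obtain ⟨m, k, h1, h2, h3, h4⟩ := exists_coprime_of_one_le_length hp hp7 hb hL hK h hn5
    exact absurd (key m k h1 h2 h3) (by omega)
  have one' : ∀ j, j * (b + t) ≤ n → n ≤ 5 * b → 1 ≤ L → j * (L * t) < b :=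
      fun j hj hn5 hL => by
    by_contra! h
    nlinarith [one hn5 hL, Nat.mul_le_mul_left (L * t) hj, Nat.mul_le_mul_right (b + t) h]
  have hP : L * 2 ≤ L * t := by gcongr
  have hK₁ : L * t + 2 * L + t + 2 ≤ b := by linarith
  have hK₂ : b < L * t + 2 * L + 2 * t + 4 := by linarith
  clear hK hK'
  simp only [add_mul] at two
  by_cases h7 : 7 * (b + t) ≤ n
  · have := two 7 h7
    omega
  by_cases h5 : 5 * (b + t) ≤ n
  · have := two 5 h5
    omega
  by_cases h4 : 4 * (b + t) ≤ n
  · have h1 := one' 4 h4 (by omega)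
    have h2 := two 4 h4
    have hL : L ≤ 1 := by
      by_contra! hL
      nlinarith [h1 (by omega)]
    interval_cases L <;> omega
  by_cases h3 : 3 * (b + t) ≤ n
  · have h1 := one' 3 h3 (by omega)
    have h2 := two 3 h3
    have hL : L ≤ 3 := by
      by_contra! hL
      nlinarith [h1 (by omega), Nat.mul_le_mul hL ht]
    interval_cases L <;> omega
  rcases ht.eq_or_lt with rfl | ht3
  · obtain ⟨d, rfl⟩ : ∃ d, n = 2 * b + 4 + d := ⟨n - (2 * b + 4), by omega⟩
    have hd : d ≤ 15 := by
      by_contra! hd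
      have h1 := one (by omega) (by omega)
      nlinarith
    obtain ⟨m, k, h1, h2, h3, h4⟩ := exists_coprime_of_small_gap (b := b) (d := d) hp hp7
      (by omega) (by omega) hd
    exact absurd (key m k h1 h2 h3) (by omega)
  · have h1 := one' 2 hc.le (by omega)
    have hL : L ≤ 8 := by
      by_contra! hL
      have h2 := h1 (by omega)
      obtain ⟨x, rfl⟩ := Nat.exists_eq_add_of_le (show 9 ≤ L from hL)
      obtain ⟨y, rfl⟩ := Nat.exists_eq_add_of_le (show 3 ≤ t from ht3)
      linarith [Nat.zero_le (x * y)]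
    interval_cases L <;> omega

end

theorem stmt_10 (p μ n a b c : ℕ) (hp : p.Prime) (hp7 : 7 ≤ p) (hμ : 2 ≤ μ)
    (hn : n = p ^ μ) (hn289 : 289 ≤ n)
    (ha : 4 ≤ a) (hab : a ≤ b) (hbc : b < c) (hc : 2 * c < n)
    (hcab : c = a + b - 2)
    (hzs : n ∣ ∑ i, (![1, 1, c, n - b, n - a] : Fin 5 → ℕ) i)
    (hmin : ∀ s : Finset (Fin 5), s.Nonempty → s ≠ Finset.univ →
      ¬ n ∣ ∑ i ∈ s, (![1, 1, c, n - b, n - a] : Fin 5 → ℕ) i) :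
    ∃ m : ℕ, Nat.gcd m n = 1 ∧
      lpr n m + lpr n m + lpr n (m * c) + lpr n (m * (n - b)) +
        lpr n (m * (n - a)) = n := by
  obtain ⟨t, rfl⟩ := Nat.exists_eq_add_of_le' (show 2 ≤ a by omega)
  obtain rfl : c = b + t := by omega
  obtain ⟨m, k, h1, h2, h3, h4⟩ := exists_coprime_mul_between hp hp7 hn289 (by omega) hab hc
  have hm : Nat.gcd m n = 1 := by
    rw [hn]
    exact Nat.Coprime.pow_right μ h1
  exact ⟨m, hm, lpr_sum_eq_of_mul_between ha hab hc (by omega) hm h2 h3 h4⟩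
end

section
/- Let n = p^μ be a prime power with p ≥ 7 and μ ≥ 2, and let x1, x2, x3, x4, x5 ∈ [1, n−1] with x1 = x2 = gcd(n, x1) > 1 and gcd(n, x1, x2, x3, x4, x5) = 1, such that (x1, x2, x3, x4, x5) is a minimal zero-sum sequence over Z/n. Then there exists a unit m modulo n with Σ_{i=1}^{5} |m·x_i|_n = n. -/
theorem mod_add_mod_add_one {q α β : ℕ} (hq : 0 < q) (h : q ∣ α + β + 1) :
    α % q + β % q + 1 = q := by
  have hα := Nat.mod_lt α hq
  have hβ := Nat.mod_lt β hq
  have h' : q ∣ α % q + β % q + 1 := by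
    rw [Nat.dvd_iff_mod_eq_zero] at h ⊢
    simpa [Nat.add_mod] using h
  obtain ⟨t, ht⟩ := h'
  have h1 : t < 2 := by
    by_contra! h2
    nlinarith
  have h0 : t ≠ 0 := by rintro rfl; omega
  obtain rfl : t = 1 := by omega
  omega

theorem two_mul_sum_affine_mod (d q z y : ℕ) [NeZero d] (hqd : q ∣ d) (hy : Nat.Coprime y q) :
    2 * ∑ k : ZMod d, (z + k.val * y) % q + d = d * q := by
  have hd : 0 < d := Nat.pos_of_ne_zero (NeZero.ne d)
  have hq : 0 < q := Nat.pos_of_dvd_of_pos hqd hd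
  have : NeZero q := ⟨hq.ne'⟩
  obtain ⟨c, hc⟩ : ∃ c : ℕ, q ∣ 2 * z + c * y + 1 := by
    refine ⟨((-(2 * z + 1 : ZMod q)) * (y : ZMod q)⁻¹).val, ?_⟩
    rw [← ZMod.natCast_eq_zero_iff]
    push_cast
    rw [ZMod.natCast_zmod_val, mul_assoc, mul_comm (y : ZMod q)⁻¹, ZMod.coe_mul_inv_eq_one _ hy]
    ring
  have hpair : ∀ k : ZMod d,
      (z + k.val * y) % q + (z + ((c : ZMod d) - k).val * y) % q + 1 = q := by
    intro k
    apply mod_add_mod_add_one hq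
    have hk : ((k.val + ((c : ZMod d) - k).val : ℕ) : ZMod q) = (c : ZMod q) := by
      rw [ZMod.natCast_eq_natCast_iff]
      refine Nat.ModEq.of_dvd hqd ?_
      rw [← ZMod.natCast_eq_natCast_iff]
      push_cast
      rw [ZMod.natCast_zmod_val, ZMod.natCast_zmod_val]
      ring
    rw [← ZMod.natCast_eq_zero_iff] at hc ⊢
    rw [← hc]
    push_cast at hk ⊢
    rw [← hk]
    ring
  have hrefl : ∑ k : ZMod d, (z + ((c : ZMod d) - k).val * y) % q
      = ∑ k : ZMod d, (z + k.val * y) % q :=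
    Equiv.sum_comp (Equiv.subLeft (c : ZMod d)) (fun k : ZMod d => (z + k.val * y) % q)
  have hsum := Finset.sum_congr rfl (fun k (_ : k ∈ (Finset.univ : Finset (ZMod d))) => hpair k)
  simp only [Finset.sum_add_distrib, hrefl, Finset.sum_const, Finset.card_univ, ZMod.card,
    smul_eq_mul, mul_one] at hsum
  omega

theorem two_mul_sum_lpr_lt (d M q z y : ℕ) [NeZero d] (hqd : q ∣ d) (hy : Nat.Coprime y q)
    (hz : ¬ M ∣ z) (hM : 0 < M) :
    2 * ∑ k : ZMod d, lpr (M * q) (z + M * (k.val * y)) < d * (M * q + M) := by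
  have hd : 0 < d := Nat.pos_of_ne_zero (NeZero.ne d)
  have hval : ∀ k : ZMod d,
      lpr (M * q) (z + M * (k.val * y)) = z % M + M * ((z / M + k.val * y) % q) := by
    intro k
    have h1 : (z + M * (k.val * y)) % (M * q) = z % M + M * ((z / M + k.val * y) % q) := by
      rw [Nat.mod_mul, Nat.add_mul_mod_self_left, Nat.add_mul_div_left _ _ hM]
    have h2 : z % M ≠ 0 := fun h => hz (Nat.dvd_of_mod_eq_zero h)
    rw [lpr, h1, if_neg (by omega)]
  have hs := two_mul_sum_affine_mod d q (z / M) y hqd hy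
  have hr := Nat.mod_lt z hM
  simp only [hval, Finset.sum_add_distrib, ← Finset.mul_sum, Finset.sum_const, Finset.card_univ,
    ZMod.card, smul_eq_mul]
  nlinarith

theorem two_mul_sum_lpr_lt_of_pow {p a e b : ℕ} (hp : p.Prime) (he : 0 < e) (hb : b ≤ a)
    {m₀ y : ℕ} (hm₀ : ¬ p ∣ m₀) (hy : ¬ p ∣ y) [NeZero (p ^ a)] :
    2 * ∑ k : ZMod (p ^ a), lpr (p ^ e * p ^ a) ((m₀ + k.val * p ^ e) * (p ^ b * y))
      < p ^ a * (p ^ e * p ^ a + p ^ e * p ^ b) := by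
  have hpos : 0 < p := hp.pos
  have h := two_mul_sum_lpr_lt (p ^ a) (p ^ e * p ^ b) (p ^ (a - b)) (m₀ * (p ^ b * y)) y
    (pow_dvd_pow p (Nat.sub_le a b)) ((hp.coprime_iff_not_dvd.2 hy).symm.pow_right _)
    (by
      intro hdvd
      have h1 : p ^ b * p ^ e ∣ p ^ b * (m₀ * y) := by
        convert hdvd using 1 <;> ring
      have h2 := (dvd_pow_self p he.ne').trans (Nat.dvd_of_mul_dvd_mul_left (pow_pos hpos b) h1)
      exact (hp.dvd_mul.1 h2).elim hm₀ hy)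
    (by positivity)
  have hn : p ^ e * p ^ b * p ^ (a - b) = p ^ e * p ^ a := by
    rw [mul_assoc, ← pow_add, Nat.add_sub_cancel' hb]
  rw [hn] at h
  convert h using 6
  ring

theorem lpr_pos {n : ℕ} (hn : 0 < n) (x : ℕ) : 0 < lpr n x := by
  unfold lpr; split_ifs <;> omega

theorem lpr_modEq (n x : ℕ) : lpr n x ≡ x [MOD n] := by
  unfold lpr Nat.ModEq
  split_ifs with h <;> simp [h]

theorem lpr_congr {n x y : ℕ} (h : x ≡ y [MOD n]) : lpr n x = lpr n y := by
  unfold lpr; rw [h]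

theorem lpr_of_lt {n x : ℕ} (h0 : 0 < x) (h : x < n) : lpr n x = x := by
  unfold lpr; rw [Nat.mod_eq_of_lt h, if_neg h0.ne']

theorem exists_multiplier_of_sum_lt {p a e m₀ u v w : ℕ} (hp : p.Prime) (he : 0 < e)
    [NeZero (p ^ a)] (hm₀ : ¬ p ∣ m₀) (hm₀lt : m₀ < p ^ e)
    (hzs : p ^ e * p ^ a ∣ 2 * p ^ a + u + v + w)
    (hsum : ∑ k : ZMod (p ^ a), (lpr (p ^ e * p ^ a) ((m₀ + k.val * p ^ e) * u)
      + lpr (p ^ e * p ^ a) ((m₀ + k.val * p ^ e) * v)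
      + lpr (p ^ e * p ^ a) ((m₀ + k.val * p ^ e) * w) + 2 * (m₀ * p ^ a))
      < p ^ a * (2 * (p ^ e * p ^ a))) :
    ∃ m : ℕ, Nat.gcd m (p ^ e * p ^ a) = 1 ∧
      2 * lpr (p ^ e * p ^ a) (m * p ^ a) + lpr (p ^ e * p ^ a) (m * u)
        + lpr (p ^ e * p ^ a) (m * v) + lpr (p ^ e * p ^ a) (m * w) = p ^ e * p ^ a := by
  have hpos : 0 < p := hp.pos
  have hda : 0 < p ^ a := pow_pos hpos a
  have hconst : p ^ a * (2 * (p ^ e * p ^ a)) = ∑ _k : ZMod (p ^ a), 2 * (p ^ e * p ^ a) := by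
    simp [ZMod.card]
  rw [hconst] at hsum
  obtain ⟨k, -, hk⟩ := Finset.exists_lt_of_sum_lt hsum
  have hm : ¬ p ∣ m₀ + k.val * p ^ e := fun h => hm₀
    ((Nat.dvd_add_left (Dvd.dvd.mul_left (dvd_pow_self p he.ne') _)).1 h)
  have hm₀pos : 0 < m₀ := Nat.pos_of_ne_zero fun h => hm₀ (h ▸ dvd_zero p)
  have hlpr : lpr (p ^ e * p ^ a) ((m₀ + k.val * p ^ e) * p ^ a) = m₀ * p ^ a := by
    rw [lpr_congr (y := m₀ * p ^ a), lpr_of_lt (Nat.mul_pos hm₀pos hda)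
      (Nat.mul_lt_mul_of_pos_right hm₀lt hda)]
    have : (m₀ + k.val * p ^ e) * p ^ a = m₀ * p ^ a + p ^ e * p ^ a * k.val := by ring
    rw [this]
    simp [Nat.ModEq]
  refine ⟨m₀ + k.val * p ^ e, ?_, ?_⟩
  · have hcop := (hp.coprime_iff_not_dvd.2 hm).symm
    exact (hcop.pow_right e).mul_right (hcop.pow_right a)
  · set m := m₀ + k.val * p ^ e
    set n := p ^ e * p ^ a
    have hn : 0 < n := by positivity
    have hmod : 2 * lpr n (m * p ^ a) + lpr n (m * u) + lpr n (m * v) + lpr n (m * w)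
        ≡ m * (2 * p ^ a + u + v + w) [MOD n] := by
      have := ((((lpr_modEq n (m * p ^ a)).mul_left 2).add (lpr_modEq n (m * u))).add
        (lpr_modEq n (m * v))).add (lpr_modEq n (m * w))
      convert this using 1
      ring
    have hdvd : n ∣ 2 * lpr n (m * p ^ a) + lpr n (m * u) + lpr n (m * v) + lpr n (m * w) :=
      (hmod.dvd_iff dvd_rfl).2 (hzs.mul_left m)
    have hu := lpr_pos hn (m * u)
    rw [hlpr] at hdvd ⊢
    obtain ⟨t, ht⟩ := hdvd
    have ht2 : t < 2 := by
      by_contra! h2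
      nlinarith
    have ht0 : t ≠ 0 := by rintro rfl; omega
    obtain rfl : t = 1 := by omega
    omega

theorem exists_two_pow_mul_lt {j N : ℕ} (hj : 0 < j) (hjN : j < N) :
    ∃ s : ℕ, 2 ^ s * j < N ∧ N ≤ 2 * 2 ^ s * j := by
  have h0 : (N - 1) / j ≠ 0 := (Nat.div_pos (by omega) hj).ne'
  have h1 := Nat.pow_log_le_self 2 h0
  have h2 := Nat.lt_pow_succ_log_self (b := 2) (by norm_num) ((N - 1) / j)
  refine ⟨Nat.log 2 ((N - 1) / j), ?_, ?_⟩
  · have := (Nat.le_div_iff_mul_le hj).1 h1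
    omega
  · have := (Nat.div_lt_iff_lt_mul hj).1 h2
    rw [pow_succ] at this
    rw [mul_comm 2]
    omega

theorem exists_multiplier_two_units {p a e u v w : ℕ} (hp : p.Prime) (hp7 : 7 ≤ p)
    (ha : 0 < a) (he : 0 < e) (hu : ¬ p ∣ u) (hv : ¬ p ∣ v)
    (hw0 : 0 < w) (hwlt : w < p ^ e * p ^ a)
    (hw1 : ¬ p ^ e * p ^ a ∣ p ^ a + w) (hw2 : ¬ p ^ e * p ^ a ∣ 2 * p ^ a + w)
    (hzs : p ^ e * p ^ a ∣ 2 * p ^ a + u + v + w) :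
    ∃ m : ℕ, Nat.gcd m (p ^ e * p ^ a) = 1 ∧
      2 * lpr (p ^ e * p ^ a) (m * p ^ a) + lpr (p ^ e * p ^ a) (m * u)
        + lpr (p ^ e * p ^ a) (m * v) + lpr (p ^ e * p ^ a) (m * w) = p ^ e * p ^ a := by
  have hpos : 0 < p := hp.pos
  have hda : 0 < p ^ a := pow_pos hpos a
  have : NeZero (p ^ a) := ⟨hda.ne'⟩
  have hd7 : 7 ≤ p ^ a := hp7.trans (Nat.le_self_pow ha.ne' p)
  have hN7 : 7 ≤ p ^ e := hp7.trans (Nat.le_self_pow he.ne' p)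
  by_cases hdw : p ^ a ∣ w
  · obtain ⟨c, rfl⟩ := hdw
    have hc0 : 0 < c := Nat.pos_of_mul_pos_left hw0
    have hcN : c < p ^ e := by
      rw [mul_comm] at hwlt
      exact Nat.lt_of_mul_lt_mul_right hwlt
    obtain ⟨j, hj⟩ := Nat.exists_eq_add_of_lt hcN
    have hj3 : 3 ≤ j + 1 := by
      have h1 : j ≠ 0 := by
        rintro rfl
        exact hw1 ⟨1, by rw [hj]; ring⟩
      have h2 : j ≠ 1 := by
        rintro rfl
        exact hw2 ⟨1, by rw [hj]; ring⟩
      omega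
    obtain ⟨s, hs1, hs2⟩ := exists_two_pow_mul_lt (j := j + 1) (N := p ^ e) (by omega) (by omega)
    have hs : ¬ p ∣ 2 ^ s := fun h => by
      have := Nat.le_of_dvd (by norm_num) (hp.dvd_of_dvd_pow h)
      omega
    have hspos : 0 < 2 ^ s := by positivity
    have hwval : ∀ k : ZMod (p ^ a),
        lpr (p ^ e * p ^ a) ((2 ^ s + k.val * p ^ e) * (p ^ a * c))
          = (p ^ e - 2 ^ s * (j + 1)) * p ^ a := by
      intro k
      obtain ⟨t, ht⟩ := Nat.exists_eq_add_of_lt hs1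
      have ht' : p ^ e - 2 ^ s * (j + 1) = t + 1 := by omega
      rw [ht', ← lpr_of_lt (n := p ^ e * p ^ a) (x := (t + 1) * p ^ a) (by positivity)
        (Nat.mul_lt_mul_of_pos_right (by
          have : 0 < 2 ^ s * (j + 1) := by positivity
          omega) hda)]
      apply lpr_congr
      have hsplit : (2 ^ s + k.val * p ^ e) * (p ^ a * c) + p ^ e * p ^ a
          = (t + 1) * p ^ a + p ^ e * p ^ a * (2 ^ s + k.val * c) := by
        have hcj : 2 ^ s * p ^ e = 2 ^ s * c + 2 ^ s * (j + 1) := by rw [hj]; ring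
        calc _ = p ^ a * (2 ^ s * c + p ^ e + k.val * p ^ e * c) := by ring
          _ = p ^ a * (2 ^ s * c + (2 ^ s * (j + 1) + t + 1) + k.val * p ^ e * c) := by rw [← ht]
          _ = p ^ a * ((2 ^ s * c + 2 ^ s * (j + 1)) + (t + 1) + k.val * p ^ e * c) := by ring
          _ = p ^ a * (2 ^ s * p ^ e + (t + 1) + k.val * p ^ e * c) := by rw [← hcj]
          _ = _ := by ring
      have := congrArg (· % (p ^ e * p ^ a)) hsplit
      simpa [Nat.ModEq] using this
    apply exists_multiplier_of_sum_lt hp he hs (by nlinarith) hzs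
    have h1 := two_mul_sum_lpr_lt_of_pow hp he (Nat.zero_le a) hs hu
    have h2 := two_mul_sum_lpr_lt_of_pow hp he (Nat.zero_le a) hs hv
    simp only [pow_zero, one_mul, mul_one] at h1 h2
    simp only [Finset.sum_add_distrib, hwval, Finset.sum_const, Finset.card_univ, ZMod.card,
      smul_eq_mul]
    obtain ⟨i, rfl⟩ : ∃ i, j = i + 2 := ⟨j - 2, by omega⟩
    have hkey : p ^ e + 2 * (2 ^ s * p ^ a) ≤ 2 ^ s * (i + 2 + 1) * p ^ a := by
      have h6 : p ^ e ≤ 6 * (2 ^ s * (i + 1)) := by nlinarith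
      have h7 : 7 * (2 ^ s * (i + 1)) ≤ p ^ a * (2 ^ s * (i + 1)) := Nat.mul_le_mul_right _ hd7
      nlinarith
    obtain ⟨r, hr⟩ := Nat.exists_eq_add_of_lt hs1
    have hr' : p ^ e - 2 ^ s * (i + 2 + 1) = r + 1 := by omega
    rw [hr']
    have hr2 : p ^ e * p ^ a = 2 ^ s * (i + 2 + 1) * p ^ a + (r + 1) * p ^ a := by
      rw [← add_mul]; congr 1
    have hfin : p ^ e * p ^ a + p ^ e + (r + 1) * p ^ a + 2 * (2 ^ s * p ^ a)
        ≤ 2 * (p ^ e * p ^ a) := by omega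
    have := Nat.mul_le_mul_left (p ^ a) hfin
    simp only [mul_add] at this h1 h2 ⊢
    omega
  · obtain ⟨b, y, hy, rfl⟩ := Nat.exists_eq_pow_mul_and_not_dvd hw0.ne' p hp.ne_one
    have hba : b < a := by
      by_contra! h
      exact hdw ((pow_dvd_pow p h).mul_right y)
    have h1p : ¬ p ∣ 1 := hp.not_dvd_one
    apply exists_multiplier_of_sum_lt hp he h1p (by omega) hzs
    have h1 := two_mul_sum_lpr_lt_of_pow hp he (Nat.zero_le a) h1p hu
    have h2 := two_mul_sum_lpr_lt_of_pow hp he (Nat.zero_le a) h1p hv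
    have h3 := two_mul_sum_lpr_lt_of_pow hp he hba.le h1p hy
    simp only [pow_zero, one_mul, mul_one] at h1 h2 h3 ⊢
    simp only [Finset.sum_add_distrib, Finset.sum_const, Finset.card_univ, ZMod.card,
      smul_eq_mul]
    have hb7 : 7 * p ^ b ≤ p ^ a := by
      calc 7 * p ^ b ≤ p * p ^ b := Nat.mul_le_mul_right _ hp7
        _ = p ^ (b + 1) := by ring
        _ ≤ p ^ a := Nat.pow_le_pow_right hpos hba
    have e1 := Nat.mul_le_mul_left (p ^ e) hd7
    have e2 := Nat.mul_le_mul_right (p ^ a) hN7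
    have e3 := Nat.mul_le_mul_left (p ^ e) hb7
    have hfin : 2 * p ^ e + p ^ e * p ^ b + 4 * p ^ a ≤ p ^ e * p ^ a := by
      rw [mul_left_comm] at e3
      omega
    have := Nat.mul_le_mul_left (p ^ a) hfin
    simp only [mul_add, mul_left_comm (p ^ a) 2, mul_left_comm (p ^ a) 4] at this h1 h2 h3 ⊢
    omega

theorem stmt_12 (p μ n : ℕ) (hp : p.Prime) (hp7 : 7 ≤ p) (hμ : 2 ≤ μ)
    (hn : n = p ^ μ) (x : Fin 5 → ℕ)
    (hx : ∀ i, 1 ≤ x i ∧ x i ≤ n - 1)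
    (h12 : x 0 = x 1) (h0g : x 0 = Nat.gcd n (x 0)) (h0gt : 1 < x 0)
    (hgcd : Nat.gcd n (Nat.gcd (x 0) (Nat.gcd (x 1) (Nat.gcd (x 2)
      (Nat.gcd (x 3) (x 4))))) = 1)
    (hzs : n ∣ ∑ i, x i)
    (hmin : ∀ s : Finset (Fin 5), s.Nonempty → s ≠ Finset.univ →
      ¬ n ∣ ∑ i ∈ s, x i) :
    ∃ m : ℕ, Nat.gcd m n = 1 ∧ (∑ i, lpr n (m * x i)) = n := by
  have hpos : 0 < p := hp.pos
  have hnpos : 0 < n := hn ▸ pow_pos hpos μ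
  have hx0n : x 0 ∣ p ^ μ := by
    rw [h0g, ← hn]
    exact Nat.gcd_dvd_left n (x 0)
  obtain ⟨a, haμ, hxa⟩ := (Nat.dvd_prime_pow hp).1 hx0n
  have ha : 0 < a := Nat.pos_of_ne_zero fun h => by
    rw [h, pow_zero] at hxa
    omega
  have hne : a ≠ μ := by
    rintro rfl
    have := hx 0
    omega
  obtain ⟨e, rfl⟩ := Nat.exists_eq_add_of_le haμ
  have he : 0 < e := by omega
  rw [add_comm a e, pow_add] at hn
  subst hn
  have hxa1 : x 1 = p ^ a := h12 ▸ hxa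
  have hlt : ∀ i, x i < p ^ e * p ^ a := fun i => by have := hx i; omega
  simp only [Fin.sum_univ_five, hxa, hxa1] at hzs hgcd ⊢
  have hpa : p ∣ p ^ a := dvd_pow_self p ha.ne'
  have hpn : p ∣ p ^ e * p ^ a := hpa.mul_left _
  have hone : ∀ i : Fin 5, i ≠ 0 → i ≠ 1 → ¬ p ^ e * p ^ a ∣ p ^ a + x i := by
    intro i hi0 hi1 h
    refine hmin {0, i} ⟨0, by simp⟩ ?_ ?_
    · intro h
      have := congrArg Finset.card h
      rw [Finset.card_pair hi0.symm] at this
      simp at this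
    · rwa [Finset.sum_pair hi0.symm, hxa]
  have htwo : ∀ i : Fin 5, i ≠ 0 → i ≠ 1 → ¬ p ^ e * p ^ a ∣ 2 * p ^ a + x i := by
    intro i hi0 hi1 h
    have hmem : (0 : Fin 5) ∉ ({1, i} : Finset (Fin 5)) := by simp [hi0.symm]
    refine hmin {0, 1, i} ⟨0, by simp⟩ ?_ ?_
    · intro h
      have := congrArg Finset.card h
      rw [Finset.card_insert_of_notMem hmem, Finset.card_pair hi1.symm] at this
      simp at this
    · rwa [Finset.sum_insert hmem, Finset.sum_pair hi1.symm, hxa, hxa1, ← add_assoc, ← two_mul]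
  have hps : p ∣ x 2 + x 3 + x 4 := by
    have h1 : p ∣ 2 * p ^ a + (x 2 + x 3 + x 4) := by
      have := hpn.trans hzs
      rwa [← two_mul, add_assoc, add_assoc, ← add_assoc (x 2)] at this
    exact (Nat.dvd_add_right (hpa.mul_left 2)).1 h1
  have hnot : ¬ (p ∣ x 2 ∧ p ∣ x 3 ∧ p ∣ x 4) := by
    rintro ⟨h2, h3, h4⟩
    apply hp.not_dvd_one
    rw [← hgcd]
    exact Nat.dvd_gcd hpn (Nat.dvd_gcd hpa (Nat.dvd_gcd hpa
      (Nat.dvd_gcd h2 (Nat.dvd_gcd h3 h4))))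
  have key := fun (i j k : Fin 5) (hi : ¬ p ∣ x i) (hj : ¬ p ∣ x j) (hk0 : k ≠ 0) (hk1 : k ≠ 1)
      hz => exists_multiplier_two_units (u := x i) (v := x j) (w := x k) hp hp7 ha he hi hj
        (hx k).1 (hlt k) (hone k hk0 hk1) (htwo k hk0 hk1) hz
  by_cases h2 : p ∣ x 2
  · have h34 : p ∣ x 3 + x 4 := by
      rw [add_assoc] at hps
      exact (Nat.dvd_add_right h2).1 hps
    have h3 : ¬ p ∣ x 3 := fun h => hnot ⟨h2, h, (Nat.dvd_add_right h).1 h34⟩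
    have h4 : ¬ p ∣ x 4 := fun h => hnot ⟨h2, (Nat.dvd_add_left h).1 h34, h⟩
    obtain ⟨m, hm, hs⟩ := key 3 4 2 h3 h4 (by decide) (by decide) (by convert hzs using 1; ring)
    exact ⟨m, hm, by omega⟩
  · by_cases h3 : p ∣ x 3
    · have h4 : ¬ p ∣ x 4 := fun h =>
        h2 ((Nat.dvd_add_left h3).1 ((Nat.dvd_add_left h).1 hps))
      obtain ⟨m, hm, hs⟩ := key 2 4 3 h2 h4 (by decide) (by decide) (by convert hzs using 1; ring)
      exact ⟨m, hm, by omega⟩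
    · obtain ⟨m, hm, hs⟩ := key 2 3 4 h2 h3 (by decide) (by decide) (by convert hzs using 1; ring)
      exact ⟨m, hm, by omega⟩
end

section
/- Let n = p^μ be a prime power with p ≥ 7, μ ≥ 2, and n ≥ 289. Let b, c be integers with c = b + 1, 2 < n/c < n/b < 3, and c < (n−1)/2, such that (1, 1, c, n−b, n−3) is a minimal zero-sum sequence over Z/n. Then there exist positive integers x, y with 1 ≤ x, y ≤ ⌊b/3⌋, n/c < 2 + x/y < n/b, and gcd(2y + x, n) = 1; consequently the sequence has index 1. -/
/-- `m / y` lies strictly between `n / (b + 1)` and `n / b`, with `1 ≤ y ≤ b / 3`. -/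
def IsApprox (n b m y : ℤ) : Prop :=
  1 ≤ y ∧ 3 * y ≤ b ∧ n * y < m * (b + 1) ∧ m * b < n * y

/-- A one-dimensional slice of the form `N / A < s`, `s + 1 < M / B` that is long enough
contains two consecutive integers. -/
lemma exists_consecutive_in_slice {A B N M e f b : ℤ} (hA : 0 < A) (hB : 0 ≤ B) (he : 0 ≤ e)
    (hM : (N + 2 * A) * B < M * A) (hb : 3 * (e * (N + 2 * A) + f * A) ≤ b * A) :
    ∃ s : ℤ, N < s * A ∧ (s + 1) * B < M ∧ 3 * (e * (s + 1) + f) ≤ b := by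
  have h1 := Int.emod_add_mul_ediv N A
  have h2 := Int.emod_nonneg N hA.ne'
  have h3 := Int.emod_lt_of_pos N hA
  have hs : (N / A + 1 + 1) * A ≤ N + 2 * A := by linarith
  refine ⟨N / A + 1, by linarith, ?_, ?_⟩
  · refine lt_of_mul_lt_mul_right ?_ hA.le
    have := mul_le_mul_of_nonneg_right hs hB
    linarith
  · refine le_of_mul_le_mul_right ?_ hA
    have := mul_le_mul_of_nonneg_left hs he
    linarith

/-- Slices along the direction `2 / 1`, used when `n / b` is close to `2`. -/
lemma exists_approx_of_near_two {n b a : ℤ} (hn : 289 ≤ n) (hna : n = 2 * b + a) (ha : 5 ≤ a)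
    (hab : 29 * a ≤ 10 * b) :
    ∃ m y y', IsApprox n b m y ∧ IsApprox n b (m + 2) y' := by
  obtain ⟨k, hk, h1, h2⟩ : ∃ k : ℤ, 1 ≤ k ∧ 2 * a ^ 2 - 4 * a < k * n ∧
      3 * k * b + 6 * a ≤ a * b := by
    rcases eq_or_lt_of_le ha with rfl | ha
    · exact ⟨1, by norm_num, by linarith, by linarith⟩
    · obtain ⟨k, hk, hk'⟩ : ∃ k : ℤ, 3 * k ≤ a - 3 ∧ a - 5 ≤ 3 * k :=
        ⟨(a - 3) / 3, by omega, by omega⟩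
      refine ⟨k, by omega, ?_, by nlinarith⟩
      have : (a - 5) * n ≤ 3 * k * n := mul_le_mul_of_nonneg_right hk' (by linarith)
      rcases le_or_gt a 28 with h | h <;> nlinarith
  obtain ⟨s, hs1, hs2, hs3⟩ := exists_consecutive_in_slice (A := a) (B := a - 2) (N := k * b)
    (M := k * (b + 1)) (e := 1) (f := 0) (b := b) (by linarith) (by linarith) (by norm_num)
    (by subst hna; linarith) (by linarith)
  have hs : 0 < s := pos_of_mul_pos_left (lt_of_le_of_lt (by nlinarith) hs1) (by linarith)
  subst hna
  exact ⟨2 * s + k, s, s + 1, ⟨by linarith, by linarith, by linarith, by linarith⟩,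
    ⟨by linarith, by linarith, by linarith, by linarith⟩⟩

/-- Slices along the direction `3 / 1`, used when `n / b` is close to `3`. -/
lemma exists_approx_of_near_three {n b t : ℤ} (hn : 289 ≤ n) (hnt : n = 3 * b - t) (ht : 1 ≤ t)
    (hb : 97 ≤ b) (htb : 3 * t ≤ b) :
    ∃ m y y', IsApprox n b m y ∧ IsApprox n b (m + 3) y' := by
  obtain ⟨z, hz, h1, h2⟩ : ∃ z : ℤ, 1 ≤ z ∧ 2 * t ^ 2 + 6 * t < z * n ∧
      3 * z * (b + 1) + 6 * (t + 3) ≤ b * (t + 3) := by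
    rcases le_or_gt t 2 with h | h
    · exact ⟨1, le_rfl, by nlinarith, by nlinarith⟩
    · obtain ⟨z, hz, hz'⟩ : ∃ z : ℤ, 3 * z ≤ t ∧ t - 2 ≤ 3 * z := ⟨t / 3, by omega, by omega⟩
      refine ⟨z, by omega, ?_, by nlinarith⟩
      have : (t - 2) * n ≤ 3 * z * n := mul_le_mul_of_nonneg_right hz' (by linarith)
      rcases le_or_gt t 20 with h | h <;> nlinarith
  obtain ⟨s, hs1, hs2, hs3⟩ := exists_consecutive_in_slice (A := t + 3) (B := t)
    (N := z * (b + 1)) (M := z * b) (e := 1) (f := 0) (b := b) (by linarith) (by linarith)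
    (by norm_num) (by subst hnt; linarith) (by linarith)
  have hs : 0 < s := pos_of_mul_pos_left (lt_of_le_of_lt (by nlinarith) hs1) (by linarith)
  subst hnt
  exact ⟨3 * s - z, s, s + 1, ⟨by linarith, by linarith, by linarith, by linarith⟩,
    ⟨by linarith, by linarith, by linarith, by linarith⟩⟩

/-- Slices along the direction `5 / 2`, used when `n / b` is slightly below `5 / 2`. -/
lemma exists_approx_of_le_five_halves {n b a u : ℤ} (hn : 289 ≤ n) (hna : n = 2 * b + a)
    (hu : b = 2 * a + u) (hu0 : 0 ≤ u) (ha : 5 ≤ a) (hb : 97 ≤ b) (hua : 10 * u ≤ 9 * a) :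
    ∃ m y y', IsApprox n b m y ∧ IsApprox n b (m + 5) y' := by
  obtain ⟨w, hw, h1, h2⟩ : ∃ w : ℤ, 1 ≤ w ∧ 2 * u ^ 2 + 10 * u < w * n ∧
      3 * w * (b + 1) + 12 * (u + 5) ≤ b * (u + 5) := by
    rcases le_or_gt u 2 with h | h
    · exact ⟨1, le_rfl, by nlinarith, by nlinarith⟩
    · obtain ⟨w, hw, hw'⟩ : ∃ w : ℤ, 3 * w ≤ u ∧ u - 2 ≤ 3 * w := ⟨u / 3, by omega, by omega⟩
      refine ⟨w, by omega, ?_, by nlinarith⟩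
      have : (u - 2) * n ≤ 3 * w * n := mul_le_mul_of_nonneg_right hw' (by linarith)
      rcases le_or_gt u 30 with h | h <;> nlinarith
  obtain ⟨s, hs1, hs2, hs3⟩ := exists_consecutive_in_slice (A := u + 5) (B := u)
    (N := w * (a - 2)) (M := w * a) (e := 2) (f := w) (b := b) (by linarith) (by linarith)
    (by norm_num) (by subst hna hu; linarith) (by subst hu; linarith)
  have hs : 0 < s := pos_of_mul_pos_left (lt_of_le_of_lt (by nlinarith) hs1) (by linarith)
  subst hna hu
  exact ⟨5 * s + 2 * w, 2 * s + w, 2 * (s + 1) + w,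
    ⟨by linarith, by linarith, by linarith, by linarith⟩,
    ⟨by linarith, by linarith, by linarith, by linarith⟩⟩

/-- Slices along the direction `5 / 2`, used when `n / b` is slightly above `5 / 2`. -/
lemma exists_approx_of_five_halves_lt {n b a v : ℤ} (hn : 289 ≤ n) (hna : n = 2 * b + a)
    (hv : b = 2 * a - v) (hv0 : 1 ≤ v) (hb : 97 ≤ b) (hvb : 3 * v ≤ b) :
    ∃ m y y', IsApprox n b m y ∧ IsApprox n b (m + 5) y' := by
  rcases lt_or_ge v 5 with hv5 | hv5
  · exact ⟨5, 2, 4, ⟨by linarith, by linarith, by linarith, by linarith⟩,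
      ⟨by linarith, by linarith, by linarith, by linarith⟩⟩
  obtain ⟨w, hw, h1, h2⟩ : ∃ w : ℤ, 1 ≤ w ∧ 2 * v ^ 2 - 10 * v < w * n ∧
      3 * w * b + 12 * v ≤ b * v := by
    rcases le_or_gt v 6 with h | h
    · exact ⟨1, le_rfl, by nlinarith, by nlinarith⟩
    · obtain ⟨w, hw, hw'⟩ : ∃ w : ℤ, 3 * w ≤ v - 4 ∧ v - 6 ≤ 3 * w :=
        ⟨(v - 4) / 3, by omega, by omega⟩
      refine ⟨w, by omega, ?_, by nlinarith⟩
      have : (v - 6) * n ≤ 3 * w * n := mul_le_mul_of_nonneg_right hw' (by linarith)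
      rcases le_or_gt v 20 with h | h <;> nlinarith
  have hwa : 0 < a * w := mul_pos (by linarith) (by linarith)
  obtain ⟨s, hs1, hs2, hs3⟩ := exists_consecutive_in_slice (A := v) (B := v - 5)
    (N := a * w) (M := w * (a - 2)) (e := 2) (f := -w) (b := b) (by linarith) (by linarith)
    (by norm_num) (by subst hna hv; linarith) (by subst hv; linarith)
  have hs : w < s := by nlinarith
  subst hna hv
  exact ⟨5 * s - 2 * w, 2 * s - w, 2 * (s + 1) - w,
    ⟨by linarith, by linarith, by linarith, by linarith⟩,
    ⟨by linarith, by linarith, by linarith, by linarith⟩⟩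

lemma exists_approx_pair {n b : ℤ} (hn : 289 ≤ n) (h2 : 2 * b + 5 ≤ n) (h3 : n < 3 * b) :
    ∃ d m y y', (d = 2 ∨ d = 3 ∨ d = 5) ∧ IsApprox n b m y ∧ IsApprox n b (m + d) y' := by
  have hb : 97 ≤ b := by omega
  rcases le_or_gt (29 * (n - 2 * b)) (10 * b) with hA | hA
  · obtain ⟨m, y, y', h⟩ := exists_approx_of_near_two (a := n - 2 * b) hn (by ring) (by omega) hA
    exact ⟨2, m, y, y', by simp, h⟩
  rcases le_or_gt (3 * (3 * b - n)) b with hD | hD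
  · obtain ⟨m, y, y', h⟩ :=
      exists_approx_of_near_three (t := 3 * b - n) hn (by ring) (by omega) hb hD
    exact ⟨3, m, y, y', by simp, h⟩
  rcases le_or_gt (2 * (n - 2 * b)) b with hB | hB
  · obtain ⟨m, y, y', h⟩ := exists_approx_of_le_five_halves (a := n - 2 * b)
      (u := b - 2 * (n - 2 * b)) hn (by ring) (by ring) (by omega) (by omega) hb (by omega)
    exact ⟨5, m, y, y', by simp, h⟩
  · obtain ⟨m, y, y', h⟩ := exists_approx_of_five_halves_lt (a := n - 2 * b)
      (v := 2 * (n - 2 * b) - b) hn (by ring) (by ring) (by omega) hb (by omega)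
    exact ⟨5, m, y, y', by simp, h⟩

lemma exists_approx_not_dvd {n b p : ℤ} (hp : 7 ≤ p) (hn : 289 ≤ n) (h2 : 2 * b + 5 ≤ n)
    (h3 : n < 3 * b) : ∃ m y, IsApprox n b m y ∧ ¬ p ∣ m := by
  obtain ⟨d, m, y, y', hd, h, h'⟩ := exists_approx_pair hn h2 h3
  by_cases hm : p ∣ m
  · refine ⟨m + d, y', h', fun hmd => ?_⟩
    have := Int.le_of_dvd (by omega) ((dvd_add_right hm).1 hmd)
    omega
  · exact ⟨m, y, h, hm⟩

lemma lpr_of_eq_add {n x r q : ℕ} (hr : 0 < r) (hrn : r < n) (h : x = r + n * q) :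
    lpr n x = r := by
  have : x % n = r := by rw [h, Nat.add_mul_mod_self_left, Nat.mod_eq_of_lt hrn]
  rw [lpr, this, if_neg hr.ne']

theorem stmt_17 (p μ n b c : ℕ) (hp : p.Prime) (hp7 : 7 ≤ p) (hμ : 2 ≤ μ)
    (hn : n = p ^ μ) (hn289 : 289 ≤ n)
    (hbc : c = b + 1) (h2c : 2 * c < n) (h3b : n < 3 * b)
    (hchalf : c < (n - 1) / 2)
    (hzs : n ∣ ∑ i, (![1, 1, c, n - b, n - 3] : Fin 5 → ℕ) i)
    (hmin : ∀ s : Finset (Fin 5), s.Nonempty → s ≠ Finset.univ →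
      ¬ n ∣ ∑ i ∈ s, (![1, 1, c, n - b, n - 3] : Fin 5 → ℕ) i) :
    (∃ x y : ℕ, 1 ≤ x ∧ x ≤ b / 3 ∧ 1 ≤ y ∧ y ≤ b / 3 ∧
      n * y < (2 * y + x) * c ∧ (2 * y + x) * b < n * y ∧
      Nat.gcd (2 * y + x) n = 1) ∧
    ∃ m : ℕ, Nat.gcd m n = 1 ∧
      lpr n m + lpr n m + lpr n (m * c) + lpr n (m * (n - b)) +
        lpr n (m * (n - 3)) = n := by
  obtain ⟨m, y, ⟨hy, hyb, h1, h2⟩, hpm⟩ := exists_approx_not_dvd (n := n) (b := b) (p := p)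
    (by omega) (by omega) (by omega) (by omega)
  have hb : (0 : ℤ) < b := by omega
  have hxpos : 2 * y < m := by
    have : (n : ℤ) * y < m * (b + 1) := h1
    have hn' : 2 * ((b : ℤ) + 1) ≤ n := by omega
    nlinarith
  have hxlt : m < 3 * y := by
    have : (n : ℤ) < 3 * b := by omega
    nlinarith
  have hmn : 3 * m < n := by nlinarith
  lift y to ℕ using by omega
  lift m to ℕ using by omega
  have hcop : Nat.gcd m n = 1 := by
    rw [hn]
    exact Nat.Coprime.pow_right _ ((hp.coprime_iff_not_dvd.2 (by exact_mod_cast hpm)).symm)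
  subst hbc
  norm_cast at h1 h2 hxpos hxlt hmn hyb hy
  have hx : 2 * y + (m - 2 * y) = m := by omega
  refine ⟨⟨m - 2 * y, y, by omega, by omega, hy, by omega, ?_, ?_, ?_⟩, m, hcop, ?_⟩
  · rwa [hx]
  · rwa [hx]
  · rwa [hx]
  · have hm : m * (b + 1) = m * b + m := by ring
    have hbn : b ≤ n := by omega
    have hym : y ≤ m := by omega
    rw [lpr_of_eq_add (r := m) (q := 0) (by omega) (by omega) (by omega),
      lpr_of_eq_add (x := m * (b + 1)) (r := m * (b + 1) - n * y) (q := y)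
        (by omega) (by omega) (by omega),
      lpr_of_eq_add (x := m * (n - b)) (r := n * y - m * b) (q := m - y)
        (by omega) (by omega) ?_,
      lpr_of_eq_add (x := m * (n - 3)) (r := n - 3 * m) (q := m - 1)
        (by omega) (by omega) ?_]
    · omega
    · zify [show 3 ≤ n by omega, hmn.le, show 1 ≤ m by omega]
      ring
    · zify [hbn, h2.le, hym]
      ring
end
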